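/- Let i ≥ 2 and j, k ≥ 1 be integers. Then ∫_▲ ṽ^II_{ijk}(x,y,z) · b̃^II_{ijk}(x,y,z) dx dy dz = 64/( (2i−1) (2j+2i−1) (2k+2i+2j−1) (k+2i+2j−1) ). -/

import Mathlib

open MeasureTheory

/-- Jacobi polynomial `P_n^{(a,b)}` via the Rodrigues formula (on `(-1,1)`). -/
noncomputable def jacobiP (n a b : ℕ) (x : ℝ) : ℝ :=
  (1 / ((2:ℝ)^n * (Nat.factorial n : ℝ) * (1 - x)^a * (1 + x)^b)) *
    iteratedDeriv n (fun t : ℝ => (1 - t)^a * (1 + t)^b * (t^2 - 1)^n) x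

/-- Legendre polynomial `L_n = P_n^{(0,0)}`. -/
noncomputable def legendreP (n : ℕ) (x : ℝ) : ℝ := jacobiP n 0 0 x

/-- Integrated Jacobi polynomial `P̂_n^a(x) = ∫_{-1}^x P_{n-1}^{(a,0)}(t) dt`. -/
noncomputable def intJacobiP (n a : ℕ) (x : ℝ) : ℝ :=
  ∫ t in (-1:ℝ)..x, jacobiP (n - 1) a 0 t

/-- Integrated Legendre polynomial `L̂_n`. -/
noncomputable def intLegendreP (n : ℕ) (x : ℝ) : ℝ := intJacobiP n 0 x

/-- The open reference tetrahedron with vertices `(-1,-1,-1)`, `(1,-1,-1)`,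
`(0,1,-1)`, `(0,0,1)`. -/
def Tet : Set (ℝ × ℝ × ℝ) :=
  {p | -1 < p.2.2 ∧ p.2.2 < 1 ∧ |p.2.1| < (1 - p.2.2) / 2 ∧
       |p.1| < (1 - 2*p.2.1 - p.2.2) / 4}

/-- Euclidean dot product in `ℝ³`. -/
def dot3 (p q : ℝ × ℝ × ℝ) : ℝ := p.1 * q.1 + p.2.1 * q.2.1 + p.2.2 * q.2.2

/-- The collapsed coordinate `η = 4x/(1-2y-z)`. -/
noncomputable def etaT (p : ℝ × ℝ × ℝ) : ℝ := 4*p.1 / (1 - 2*p.2.1 - p.2.2)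

/-- The collapsed coordinate `χ = 2y/(1-z)`. -/
noncomputable def chiT (p : ℝ × ℝ × ℝ) : ℝ := 2*p.2.1 / (1 - p.2.2)

/-- Auxiliary `H(curl)` interior field `ṽ^I_{ijk} = (∇f_i) g_{ij} h_{ijk}` on the
tetrahedron. -/
noncomputable def vtTetI (i j k : ℕ) (p : ℝ × ℝ × ℝ) : ℝ × ℝ × ℝ :=
  (legendreP (i-1) (etaT p) * (((1 - chiT p)/2)^(i-1) * ((1 - p.2.2)/2)^(i-1) *
      intJacobiP j (2*i) (chiT p) * ((1 - p.2.2)/2)^j * intJacobiP k (2*i+2*j) p.2.2),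
   (1/2) * legendreP (i-2) (etaT p) * (((1 - chiT p)/2)^(i-1) * ((1 - p.2.2)/2)^(i-1) *
      intJacobiP j (2*i) (chiT p) * ((1 - p.2.2)/2)^j * intJacobiP k (2*i+2*j) p.2.2),
   (1/4) * legendreP (i-2) (etaT p) * (((1 - chiT p)/2)^(i-1) * ((1 - p.2.2)/2)^(i-1) *
      intJacobiP j (2*i) (chiT p) * ((1 - p.2.2)/2)^j * intJacobiP k (2*i+2*j) p.2.2))

/-- Auxiliary `H(curl)` interior field `ṽ^II_{ijk} = f_i (∇g_{ij}) h_{ijk}` on the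
tetrahedron. -/
noncomputable def vtTetII (i j k : ℕ) (p : ℝ × ℝ × ℝ) : ℝ × ℝ × ℝ :=
  (0,
   jacobiP (j-1) (2*i) 0 (chiT p) * (((1 - p.2.2)/2)^(j-1) * intLegendreP i (etaT p) *
      ((1 - chiT p)/2)^i * ((1 - p.2.2)/2)^i * intJacobiP k (2*i+2*j) p.2.2),
   ((chiT p/2) * jacobiP (j-1) (2*i) 0 (chiT p) - ((j:ℝ)/2) * intJacobiP j (2*i) (chiT p)) *
     (((1 - p.2.2)/2)^(j-1) * intLegendreP i (etaT p) *
      ((1 - chiT p)/2)^i * ((1 - p.2.2)/2)^i * intJacobiP k (2*i+2*j) p.2.2))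

/-- Auxiliary `H(curl)` interior field `ṽ^III_{ijk} = f_i g_{ij} ∇h_{ijk}` on the
tetrahedron. -/
noncomputable def vtTetIII (i j k : ℕ) (p : ℝ × ℝ × ℝ) : ℝ × ℝ × ℝ :=
  (0, 0,
   jacobiP (k-1) (2*i+2*j) 0 p.2.2 * (intLegendreP i (etaT p) * ((1 - chiT p)/2)^i *
      ((1 - p.2.2)/2)^i * intJacobiP j (2*i) (chiT p) * ((1 - p.2.2)/2)^j))

/-- The auxiliary polynomial `Q^{l,m}_1`. -/
noncomputable def Qtet1 (l m : ℕ) (x : ℝ) : ℝ :=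
  jacobiP (m-1) (2*l-1) 1 x + ((m:ℝ) / (2*(l:ℝ) + (m:ℝ) - 1)) * jacobiP (m-1) (2*l) 0 x

/-- The auxiliary polynomial `Q^{l,m}_2`. -/
noncomputable def Qtet2 (l m : ℕ) (x : ℝ) : ℝ :=
  -(x/2) * jacobiP (m-1) (2*l-1) 1 x +
    ((m:ℝ) / (2*(l:ℝ) + (m:ℝ) - 1)) * ((1 - x)/2) * jacobiP (m-1) (2*l) 0 x

/-- Dual candidate `b̃^I_{lmn}` on the tetrahedron. -/
noncomputable def btTetI (l m n : ℕ) (p : ℝ × ℝ × ℝ) : ℝ × ℝ × ℝ :=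
  (legendreP (l-1) (etaT p) * ((1 - chiT p)/2)^(l-1) * jacobiP (m-1) (2*l-1) 1 (chiT p) *
     (((1 - p.2.2)/2)^(l+m-2) * jacobiP (n-1) (2*l+2*m-1) 1 p.2.2),
   0, 0)

/-- Dual candidate `b̃^II_{lmn}` on the tetrahedron. -/
noncomputable def btTetII (l m n : ℕ) (p : ℝ × ℝ × ℝ) : ℝ × ℝ × ℝ :=
  (((l:ℝ) + 1) * jacobiP (l-1) 1 1 (etaT p) * (((1 - chiT p)/2)^(l-1) *
      jacobiP (m-1) (2*l) 0 (chiT p) * ((1 - p.2.2)/2)^(l+m-2) *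
      jacobiP (n-1) (2*l+2*m-1) 1 p.2.2),
   -2*(l:ℝ) * jacobiP (l-2) 1 1 (etaT p) * (((1 - chiT p)/2)^(l-1) *
      jacobiP (m-1) (2*l) 0 (chiT p) * ((1 - p.2.2)/2)^(l+m-2) *
      jacobiP (n-1) (2*l+2*m-1) 1 p.2.2),
   0)

/-- Dual candidate `b̃^III_{lmn}` on the tetrahedron. -/
noncomputable def btTetIII (l m n : ℕ) (p : ℝ × ℝ × ℝ) : ℝ × ℝ × ℝ :=
  (-(((l:ℝ) + 1) / (2*(l:ℝ))) * jacobiP (l-1) 1 1 (etaT p) * ((1 - chiT p)/2)^(l-1) *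
     Qtet1 l m (chiT p) * (((1 - p.2.2)/2)^(l+m-2) * jacobiP (n-1) (2*l+2*m) 0 p.2.2),
   jacobiP (l-2) 1 1 (etaT p) * ((1 - chiT p)/2)^(l-2) * Qtet2 l m (chiT p) *
     (((1 - p.2.2)/2)^(l+m-2) * jacobiP (n-1) (2*l+2*m) 0 p.2.2),
   jacobiP (l-2) 1 1 (etaT p) * ((1 - chiT p)/2)^(l-2) * jacobiP (m-1) (2*l-1) 1 (chiT p) *
     (((1 - p.2.2)/2)^(l+m-2) * jacobiP (n-1) (2*l+2*m) 0 p.2.2))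

/-- The three types of auxiliary `H(curl)` fields / dual candidates. -/
inductive TetType | I | II | III
deriving DecidableEq

/-- The auxiliary `H(curl)` interior fields on the tetrahedron, by type. -/
noncomputable def vtTet : TetType → ℕ → ℕ → ℕ → (ℝ × ℝ × ℝ) → ℝ × ℝ × ℝ
  | .I => vtTetI
  | .II => vtTetII
  | .III => vtTetIII

/-- The dual candidates on the tetrahedron, by type. -/
noncomputable def btTet : TetType → ℕ → ℕ → ℕ → (ℝ × ℝ × ℝ) → ℝ × ℝ × ℝ
  | .I => btTetI
  | .II => btTetII
  | .III => btTetIII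

section aux
open Polynomial

noncomputable def Jq (n a b : ℕ) : ℝ[X] :=
  ∑ s ∈ Finset.range (n+1), C (((n+a).choose (n-s) : ℝ) * ((n+b).choose s : ℝ)) *
    ((X - C 1)^s * (X + C 1)^(n-s))

lemma iterDeriv_poly (n : ℕ) (p : ℝ[X]) : iteratedDeriv n (fun x => p.eval x) = fun x => (derivative^[n] p).eval x := by
  induction n with
  | zero => simp
  | succ n ih =>
    rw [iteratedDeriv_succ, ih, Function.iterate_succ_apply']
    ext x; simp

lemma Jq_rod (n a b : ℕ) :
    derivative^[n] ((X - C 1)^(a+n) * (X + C 1)^(b+n) : ℝ[X]) =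
      C (n.factorial : ℝ) * ((X - C 1)^a * (X + C 1)^b * Jq n a b) := by
  rw [iterate_derivative_mul, Jq, Finset.mul_sum, Finset.mul_sum]
  refine Finset.sum_congr rfl fun s hs => ?_
  have hs' : s ≤ n := by simpa [Nat.lt_succ_iff] using hs
  rw [iterate_derivative_X_sub_pow, iterate_derivative_X_add_pow]
  obtain ⟨t, rfl⟩ := Nat.exists_eq_add_of_le hs'
  have e1 : a + (s+t) - (s+t-s) = a + s := by omega
  have e2 : b + (s+t) - s = b + t := by omega
  have e3 : s + t - s = t := by omega
  rw [e1, e2, e3]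
  have h : ((s+t).choose s : ℝ) * ((a+(s+t)).descFactorial t) * ((b+(s+t)).descFactorial s) =
     (s+t).factorial * (((s+t+a).choose t : ℝ) * ((s+t+b).choose s : ℝ)) := by
    have := Nat.add_choose_mul_factorial_mul_factorial s t
    rw [Nat.descFactorial_eq_factorial_mul_choose, Nat.descFactorial_eq_factorial_mul_choose,
      ← this, add_comm a, add_comm b]
    rw [Nat.choose_symm_add]; push_cast; ring
  have h' := congrArg (C : ℝ → ℝ[X]) h
  simp only [map_mul, map_natCast] at h'
  simp only [nsmul_eq_mul, map_mul, map_natCast]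
  calc _ = (((s+t).choose s : ℝ[X]) * ((a+(s+t)).descFactorial t : ℝ[X]) * ((b+(s+t)).descFactorial s : ℝ[X])) *
       ((X - C 1)^(a+s) * (X + C 1)^(b+t)) := by ring
    _ = _ := by rw [h']; ring

lemma Jq_top (n a b : ℕ) :
    derivative^[n] (Jq n a b) = C ((n.factorial : ℝ) * ((2*n+a+b).choose n : ℝ)) := by
  have m (s t : ℕ) : ((X - C 1)^s * (X + C 1)^t : ℝ[X]).Monic :=
    ((monic_X_sub_C 1).pow s).mul ((monic_X_add_C 1).pow t)
  have md (s t : ℕ) : ((X - C 1)^s * (X + C 1)^t : ℝ[X]).natDegree = s + t := by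
    rw [((monic_X_sub_C (1:ℝ)).pow s).natDegree_mul ((monic_X_add_C 1).pow t),
      natDegree_pow, natDegree_pow, natDegree_X_sub_C, natDegree_X_add_C]; simp
  have hd : (Jq n a b).natDegree ≤ n := by
    refine natDegree_sum_le_of_forall_le _ _ fun s hs => ?_
    have hs' : s ≤ n := by simpa [Nat.lt_succ_iff] using hs
    refine (natDegree_C_mul_le _ _).trans ?_
    rw [md]; omega
  have hc : (Jq n a b).coeff n = ((2*n+a+b).choose n : ℝ) := by
    rw [Jq, finsetSum_coeff, show 2*n+a+b = (n+b)+(n+a) by ring, Nat.add_choose_eq,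
      Finset.Nat.sum_antidiagonal_eq_sum_range_succ_mk]
    push_cast
    refine Finset.sum_congr rfl fun s hs => ?_
    have hs' : s ≤ n := by simpa [Nat.lt_succ_iff] using hs
    have := (m s (n-s)).coeff_natDegree
    rw [md, Nat.add_sub_cancel' hs'] at this
    rw [coeff_C_mul, this]; ring
  have h0 : (derivative^[n] (Jq n a b)).natDegree ≤ 0 := by
    refine (natDegree_iterate_derivative _ _).trans (by omega)
  rw [eq_C_of_natDegree_le_zero h0, coeff_iterate_derivative, zero_add, hc,
    Nat.descFactorial_self, nsmul_eq_mul]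

lemma byparts (m : ℕ) (f F : ℝ[X])
    (h1 : ∀ k < m, (derivative^[k] F).eval 1 = 0) (h2 : ∀ k < m, (derivative^[k] F).eval (-1) = 0) :
    ∫ x in (-1:ℝ)..1, f.eval x * (derivative^[m] F).eval x =
      (-1)^m * ∫ x in (-1:ℝ)..1, (derivative^[m] f).eval x * F.eval x := by
  induction m generalizing f with
  | zero => simp
  | succ m ih =>
    rw [Function.iterate_succ_apply' , Function.iterate_succ_apply]
    have := intervalIntegral.integral_mul_deriv_eq_deriv_mul (a := -1) (b := 1)
      (u := fun x => f.eval x) (v := fun x => (derivative^[m] F).eval x)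
      (u' := fun x => (derivative f).eval x) (v' := fun x => (derivative (derivative^[m] F)).eval x)
      (fun x _ => f.hasDerivAt x) (fun x _ => Polynomial.hasDerivAt _ x)
      ((Polynomial.continuous _).intervalIntegrable _ _)
      ((Polynomial.continuous _).intervalIntegrable _ _)
    rw [this, h1 m (by omega), h2 m (by omega),
      ih (derivative f) (fun k hk => h1 k (by omega)) (fun k hk => h2 k (by omega))]
    ring

lemma beta_int (p q : ℕ) : ∫ x in (-1:ℝ)..1, (1-x)^p * (1+x)^q =
    2^(p+q+1) * p.factorial * q.factorial / (p+q+1).factorial := by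
  induction p generalizing q with
  | zero =>
    have := intervalIntegral.integral_comp_add_left (a := -1) (b := 1) (fun x : ℝ => x^q) 1
    simp only [pow_zero, one_mul, this, integral_pow]
    norm_num [Nat.factorial_succ]
    have : (q.factorial : ℝ) ≠ 0 := by positivity
    field_simp
  | succ p ih =>
    have := intervalIntegral.integral_mul_deriv_eq_deriv_mul (a := -1) (b := 1)
      (u := fun x : ℝ => (1-x)^(p+1)) (v := fun x => (1+x)^(q+1) / (q+1))
      (u' := fun x => -((p+1) * (1-x)^p)) (v' := fun x => (1+x)^q)
      (fun x _ => by
        convert (((hasDerivAt_id' x).const_sub 1).fun_pow (p+1)) using 1; push_cast; simp)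
      (fun x _ => by
        convert (((hasDerivAt_id' x).const_add 1).fun_pow (q+1)).div_const ((q:ℝ)+1) using 1
        have : (q:ℝ)+1 ≠ 0 := by positivity
        simp; field_simp)
      (Continuous.intervalIntegrable (by fun_prop) _ _)
      (Continuous.intervalIntegrable (by fun_prop) _ _)
    rw [this]
    have e : ∀ x : ℝ, -((p+1) * (1-x)^p) * ((1+x)^(q+1)/(q+1)) = (-((p+1)/(q+1))) * ((1-x)^p * (1+x)^(q+1)) := by
      intro x; ring
    simp only [e, intervalIntegral.integral_const_mul, ih]
    rw [show p+1+q+1 = p+(q+1)+1 by ring]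
    have : (q:ℝ)+1 ≠ 0 := by positivity
    have : ((p+(q+1)+1).factorial : ℝ) ≠ 0 := by positivity
    simp [Nat.factorial_succ p, Nat.factorial_succ q]
    field_simp

lemma Jq_norm (n a b : ℕ) : ∫ x in (-1:ℝ)..1, (1-x)^a * (1+x)^b * ((Jq n a b).eval x)^2 =
    ((2*n+a+b).choose n : ℝ) *
      (2^(2*n+a+b+1) * (a+n).factorial * (b+n).factorial / (2*n+a+b+1).factorial) := by
  have key := byparts n (Jq n a b) ((X - C 1)^(a+n) * (X + C 1)^(b+n)) (fun k hk => by
      have := pow_sub_dvd_iterate_derivative_of_pow_dvd k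
        (dvd_mul_right ((X - C 1 : ℝ[X])^(a+n)) ((X + C 1)^(b+n)))
      have h2 := (dvd_pow_self (X - C 1 : ℝ[X]) (show a+n-k ≠ 0 by omega)).trans this
      exact dvd_iff_isRoot.1 h2) (fun k hk => by
      have := pow_sub_dvd_iterate_derivative_of_pow_dvd k
        (dvd_mul_left ((X + C 1 : ℝ[X])^(b+n)) ((X - C 1)^(a+n)))
      have h2 := (dvd_pow_self (X + C 1 : ℝ[X]) (show b+n-k ≠ 0 by omega)).trans this
      rw [show (X + C 1 : ℝ[X]) = X - C (-1) by simp] at h2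
      rw [← IsRoot.def, ← dvd_iff_isRoot]
      convert h2 using 3; simp)
  rw [Jq_rod, Jq_top] at key
  have hf : (n.factorial : ℝ) ≠ 0 := by positivity
  have sgn : ∀ (m : ℕ) (x : ℝ), (x-1)^m = (-1)^m * (1-x)^m := by
    intro m x; rw [← mul_pow]; ring_nf
  have e1 : ∀ x : ℝ, eval x (Jq n a b) * eval x (C (n.factorial:ℝ) * ((X - C 1)^a * (X + C 1)^b * Jq n a b))
      = (n.factorial * (-1)^a) * ((1-x)^a * (1+x)^b * ((Jq n a b).eval x)^2) := by
    intro x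
    simp only [eval_mul, eval_C, eval_pow, eval_sub, eval_add, eval_X, sgn]
    ring
  have e2 : ∀ x : ℝ, eval x (C ((n.factorial:ℝ) * ((2*n+a+b).choose n : ℝ))) *
      eval x ((X - C 1)^(a+n) * (X + C 1)^(b+n))
      = (n.factorial * ((2*n+a+b).choose n : ℝ) * (-1)^(a+n)) * ((1-x)^(a+n) * (1+x)^(b+n)) := by
    intro x
    simp only [eval_mul, eval_C, eval_pow, eval_sub, eval_add, eval_X, sgn]
    ring
  simp only [e1, e2, intervalIntegral.integral_const_mul, beta_int] at key
  rw [show a+n+(b+n)+1 = 2*n+a+b+1 by ring] at key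
  have h1 : ((-1:ℝ)^a) * (-1)^a = 1 := by rw [← mul_pow]; simp
  have h2 : ((-1:ℝ)^n) * (-1)^n = 1 := by rw [← mul_pow]; simp
  apply mul_left_cancel₀ hf
  rw [pow_add (-1:ℝ)] at key
  generalize (∫ x in (-1:ℝ)..1, (1-x)^a * (1+x)^b * ((Jq n a b).eval x)^2) = I at *
  calc _ = ((-1:ℝ)^a * (-1)^a) * (n.factorial * I) := by rw [h1]; ring
    _ = (-1)^a * (n.factorial * (-1)^a * I) := by ring
    _ = _ := by
      rw [key]
      calc _ = ((-1:ℝ)^a * (-1)^a) * ((-1:ℝ)^n * (-1)^n) * (n.factorial * (((2*n+a+b).choose n : ℝ) *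
      (2^(2*n+a+b+1) * (a+n).factorial * (b+n).factorial / (2*n+a+b+1).factorial))) := by ring
        _ = _ := by rw [h1, h2]; ring

lemma Jq_B2 (n : ℕ) : derivative ((X - C 1) * (X + C 1) * Jq n 1 1) = C ((n:ℝ)+1) * Jq (n+1) 0 0 := by
  have h1 := Jq_rod n 1 1
  have h2 := Jq_rod (n+1) 0 0
  rw [Function.iterate_succ_apply', show 0 + (n+1) = 1 + n by ring, h1, derivative_C_mul] at h2
  have hf : (C (n.factorial:ℝ)) ≠ 0 := by simpa using Nat.factorial_ne_zero n
  apply mul_left_cancel₀ hf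
  simp only [pow_one] at h2
  rw [h2, Nat.factorial_succ]
  push_cast
  simp only [map_mul, map_add, map_natCast, map_one]
  ring

lemma Jq_B1 (n a : ℕ) : derivative ((X + C 1) * Jq n a 1) = C ((n:ℝ)+1) * Jq n (a+1) 0 := by
  have e : (X + C 1) * Jq n a 1 = ∑ s ∈ Finset.range (n+1), C (((n+a).choose (n-s) : ℝ) * ((n+1).choose s : ℝ)) *
    ((X - C 1)^s * (X + C 1)^(n-s+1)) := by
    rw [Jq, Finset.mul_sum]
    refine Finset.sum_congr rfl fun s _ => ?_
    ring
  have d : ∀ s t : ℕ, derivative ((X - C 1)^s * (X + C 1)^(t+1) : ℝ[X]) =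
      C (s:ℝ) * ((X - C 1)^(s-1) * (X + C 1)^(t+1)) + C ((t:ℝ)+1) * ((X - C 1)^s * (X + C 1)^t) := by
    intro s t
    rw [derivative_mul, derivative_X_sub_C_pow, derivative_X_add_C_pow]
    simp; ring_nf
  have k1 : ∀ s ∈ Finset.range (n+1), ((n+1).choose s : ℝ) * ((n-s:ℕ)+1) = (n+1) * n.choose s := by
    intro s hs
    have hs' : s ≤ n := by simpa [Nat.lt_succ_iff] using hs
    have := Nat.choose_mul_succ_eq n s
    rw [show n+1-s = n-s+1 by omega] at this
    have : ((n.choose s * (n+1) : ℕ) : ℝ) = ((n+1).choose s * (n-s+1) : ℕ) := by rw [this]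
    push_cast at this
    linarith
  rw [e, derivative_sum]
  simp only [derivative_C_mul, d, mul_add, Finset.sum_add_distrib]
  rw [Finset.sum_range_succ']
  simp only [Nat.cast_zero, map_zero, zero_mul, mul_zero, add_zero]
  have A : ∀ s ∈ Finset.range n, C (((n+a).choose (n-(s+1)) : ℝ) * ((n+1).choose (s+1) : ℝ)) *
      (C ((s+1 : ℕ):ℝ) * ((X - C 1)^(s+1-1) * (X + C 1)^(n-(s+1)+1))) =
      C ((n:ℝ)+1) * (C (((n+a).choose (n-(s+1)) : ℝ) * (n.choose s : ℝ)) * ((X - C 1)^s * (X + C 1)^(n-s))) := by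
    intro s hs
    have hs' : s < n := by simpa using hs
    rw [show n-(s+1)+1 = n-s by omega, Nat.add_sub_cancel]
    have := Nat.add_one_mul_choose_eq n s
    have : (((n+1) * n.choose s : ℕ) : ℝ) = ((n+1).choose (s+1) * (s+1) : ℕ) := by rw [this]
    push_cast at this
    rw [← mul_assoc, ← C_mul, ← mul_assoc (C ((n:ℝ)+1)), ← C_mul]
    congr 2
    push_cast
    linear_combination (-((n+a).choose (n-(s+1)):ℝ)) * this
  rw [Finset.sum_congr rfl A]
  have B : ∀ s ∈ Finset.range (n+1), C (((n+a).choose (n-s) : ℝ) * ((n+1).choose s : ℝ)) *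
      (C (((n-s:ℕ):ℝ)+1) * ((X - C 1)^s * (X + C 1)^(n-s))) =
      C ((n:ℝ)+1) * (C (((n+a).choose (n-s) : ℝ) * (n.choose s : ℝ)) * ((X - C 1)^s * (X + C 1)^(n-s))) := by
    intro s hs
    rw [← mul_assoc, ← C_mul, ← mul_assoc (C ((n:ℝ)+1)), ← C_mul]
    congr 2
    linear_combination ((n+a).choose (n-s):ℝ) * k1 s hs
  rw [Finset.sum_congr rfl B, ← Finset.mul_sum, ← Finset.mul_sum, ← mul_add]
  congr 1
  rw [Jq, Finset.sum_range_succ, Finset.sum_range_succ _ n, ← add_assoc, ← Finset.sum_add_distrib]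
  congr 1
  · refine Finset.sum_congr rfl fun s hs => ?_
    have hs' : s < n := by simpa using hs
    rw [← add_mul, ← C_add]
    congr 2
    obtain ⟨t, ht⟩ : ∃ t, n - s = t + 1 := ⟨n-s-1, by omega⟩
    rw [show n-(s+1) = t by omega, ht, ← add_assoc n a 1, Nat.choose_succ_succ']
    push_cast; ring_nf
  · simp


lemma jacobiP_eq (n a b : ℕ) (x : ℝ) (h : (1-x)^a ≠ 0) (h' : (1+x)^b ≠ 0) :
    jacobiP n a b x = (1/2^n) * (Jq n a b).eval x := by
  have hf : (fun t : ℝ => (1 - t)^a * (1 + t)^b * (t^2 - 1)^n) =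
      fun t => (C ((-1:ℝ)^a) * ((X - C 1)^(a+n) * (X + C 1)^(b+n))).eval t := by
    ext t
    simp only [eval_mul, eval_C, eval_pow, eval_sub, eval_add, eval_X]
    rw [show t^2-1 = (t-1)*(t+1) by ring, show 1 - t = (-1) * (t-1) by ring, mul_pow, mul_pow]
    ring
  rw [jacobiP, hf, iterDeriv_poly, iterate_derivative_C_mul, Jq_rod]
  simp only [eval_mul, eval_C, eval_pow, eval_sub, eval_add, eval_X]
  have hs : (-1:ℝ)^a * (x-1)^a = (1-x)^a := by rw [← mul_pow]; ring_nf
  have hF : (n.factorial : ℝ) ≠ 0 := by positivity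
  calc _ = 1 / (2^n * (n.factorial:ℝ) * (1-x)^a * (1+x)^b) *
        (n.factorial * (((-1:ℝ)^a * (x-1)^a) * (1+x)^b * eval x (Jq n a b))) := by ring
    _ = _ := by rw [hs]; field_simp

lemma int_poly (f F : ℝ[X]) (h : derivative F = f) (h0 : F.eval (-1) = 0) (x : ℝ) :
    ∫ t in (-1:ℝ)..x, f.eval t = F.eval x := by
  subst h
  rw [intervalIntegral.integral_eq_sub_of_hasDerivAt (f := fun t => F.eval t)
    (fun t _ => F.hasDerivAt t) ((Polynomial.continuous _).intervalIntegrable _ _), h0, sub_zero]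

lemma intJacobiP_eq (n a : ℕ) (x : ℝ) (h1 : -1 < x) (h2 : x < 1) :
    intJacobiP (n+1) (a+1) x = (1/2^n) * ((1+x) * (Jq n a 1).eval x / (n+1)) := by
  have h : ∫ t in (-1:ℝ)..x, jacobiP n (a+1) 0 t = ∫ t in (-1:ℝ)..x, (1/2^n) * (Jq n (a+1) 0).eval t := by
    apply intervalIntegral.integral_congr
    intro t ht
    rw [Set.uIcc_of_le h1.le] at ht
    refine jacobiP_eq n (a+1) 0 t (pow_ne_zero _ ?_) (by simp)
    have := ht.2
    linarith
  rw [intJacobiP, Nat.add_sub_cancel, h, intervalIntegral.integral_const_mul]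
  have := int_poly _ _ (Jq_B1 n a) (by simp) x
  simp only [eval_mul, eval_C, eval_add, eval_X, intervalIntegral.integral_const_mul] at this
  have hn : (n:ℝ)+1 ≠ 0 := by positivity
  rw [add_comm 1 x, ← this]
  field_simp

lemma intLegendreP_eq (n : ℕ) (x : ℝ) :
    intLegendreP (n+2) x = (1/2^(n+1)) * ((x-1) * (1+x) * (Jq n 1 1).eval x / (n+1)) := by
  have h : ∫ t in (-1:ℝ)..x, jacobiP (n+1) 0 0 t = ∫ t in (-1:ℝ)..x, (1/2^(n+1)) * (Jq (n+1) 0 0).eval t := by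
    apply intervalIntegral.integral_congr
    intro t ht
    exact jacobiP_eq (n+1) 0 0 t (by simp) (by simp)
  rw [intLegendreP, intJacobiP, show n+2-1 = n+1 by omega, h, intervalIntegral.integral_const_mul]
  have := int_poly _ _ (Jq_B2 n) (by simp) x
  simp only [eval_mul, eval_C, eval_add, eval_sub, eval_X, intervalIntegral.integral_const_mul] at this
  have hn : (n:ℝ)+1 ≠ 0 := by positivity
  rw [add_comm 1 x, ← this]
  field_simp

lemma ioo_eq (f g : ℝ → ℝ) (h : ∀ x, -1 < x → x < 1 → f x = g x) :
    ∫ x in Set.Ioo (-1:ℝ) 1, f x = ∫ x in (-1:ℝ)..1, g x := by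
  rw [intervalIntegral.integral_of_le (by norm_num), integral_Ioc_eq_integral_Ioo]
  exact setIntegral_congr_fun measurableSet_Ioo fun x hx => h x hx.1 hx.2

lemma eta_int (n : ℕ) : ∫ x in Set.Ioo (-1:ℝ) 1,
    (-2*((n:ℝ)+2)) * (intLegendreP (n+2) x * jacobiP n 1 1 x) = 8 / (2*((n:ℝ)+2)-1) := by
  rw [ioo_eq _ (fun x => (2*((n:ℝ)+2) / (2^(n+1) * 2^n * (n+1))) *
    ((1-x)^1 * (1+x)^1 * ((Jq n 1 1).eval x)^2))]
  · rw [intervalIntegral.integral_const_mul, Jq_norm, Nat.cast_choose ℝ (show n ≤ 2*n+1+1 by omega)]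
    rw [show 2*n+1+1-n = n+1+1 by omega, show 1 + n = n+1 by ring, show 2*n+1+1+1 = (2*n+2)+1 by ring,
      show 2*n+1+1 = 2*n+2 by ring, Nat.factorial_succ (2*n+2), Nat.factorial_succ (n+1), Nat.factorial_succ n]
    have h1 : (n.factorial : ℝ) ≠ 0 := by positivity
    have h2 : ((2*n+2).factorial : ℝ) ≠ 0 := by positivity
    have h3 : 2*((n:ℝ)+2)-1 ≠ 0 := by linarith [(Nat.cast_nonneg n : (0:ℝ) ≤ n)]
    have h4 : (n:ℝ)+1 ≠ 0 := by positivity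
    have h5 : (n:ℝ)+1+1 ≠ 0 := by positivity
    have h6 : 2*(n:ℝ)+2+1 ≠ 0 := by positivity
    push_cast
    field_simp
    ring
  · intro x h1 h2
    rw [intLegendreP_eq, jacobiP_eq n 1 1 x (by simp; linarith) (by simp; linarith)]
    have h4 : (n:ℝ)+1 ≠ 0 := by positivity
    field_simp
    ring

lemma chi_int (m a : ℕ) : ∫ x in Set.Ioo (-1:ℝ) 1,
    ((1-x)/2)^a * (jacobiP m a 0 x)^2 = 2 / (2*(m:ℝ)+a+1) := by
  rw [ioo_eq _ (fun x => (1 / (2^a * 2^m * 2^m)) *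
    ((1-x)^a * (1+x)^0 * ((Jq m a 0).eval x)^2))]
  · rw [intervalIntegral.integral_const_mul, Jq_norm, Nat.cast_choose ℝ (show m ≤ 2*m+a+0 by omega)]
    rw [show 2*m+a+0-m = a+m by omega, show 0+m = m by ring, 
      show 2*m+a+0 = 2*m+a by ring, Nat.factorial_succ (2*m+a)]
    have h1 : (m.factorial : ℝ) ≠ 0 := by positivity
    have h2 : ((2*m+a).factorial : ℝ) ≠ 0 := by positivity
    have h3 : ((a+m).factorial : ℝ) ≠ 0 := by positivity
    have h4 : 2*(m:ℝ)+a+1 ≠ 0 := by positivity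
    push_cast
    field_simp
    ring
  · intro x h1 h2
    rw [jacobiP_eq m a 0 x (pow_ne_zero _ (by linarith)) (by simp), div_pow]
    field_simp
    try ring

lemma z_int (n a : ℕ) : ∫ x in Set.Ioo (-1:ℝ) 1,
    ((1-x)/2)^a * (intJacobiP (n+1) (a+1) x * jacobiP n a 1 x) = 4 / ((2*(n:ℝ)+a+2)*((n:ℝ)+a+1)) := by
  rw [ioo_eq _ (fun x => (1 / (2^a * 2^n * 2^n * (n+1))) *
    ((1-x)^a * (1+x)^1 * ((Jq n a 1).eval x)^2))]
  · rw [intervalIntegral.integral_const_mul, Jq_norm, Nat.cast_choose ℝ (show n ≤ 2*n+a+1 by omega)]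
    rw [show 2*n+a+1-n = (a+n)+1 by omega, show 1+n = n+1 by ring, 
      Nat.factorial_succ (2*n+a+1), Nat.factorial_succ (a+n), Nat.factorial_succ n]
    have h1 : (n.factorial : ℝ) ≠ 0 := by positivity
    have h2 : ((2*n+a+1).factorial : ℝ) ≠ 0 := by positivity
    have h3 : ((a+n).factorial : ℝ) ≠ 0 := by positivity
    have h4 : 2*(n:ℝ)+a+2 ≠ 0 := by positivity
    have h5 : (n:ℝ)+a+1 ≠ 0 := by positivity
    have h6 : 2*(n:ℝ)+a+1+1 ≠ 0 := by positivity
    have h7 : (a:ℝ)+n+1 ≠ 0 := by positivity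
    push_cast
    field_simp
    ring
  · intro x h1 h2
    rw [intJacobiP_eq n a x h1 h2, jacobiP_eq n a 1 x (pow_ne_zero _ (by linarith)) (by simp; linarith), div_pow]
    have h4 : (n:ℝ)+1 ≠ 0 := by positivity
    field_simp

noncomputable def phiT (p : ℝ × ℝ × ℝ) : ℝ × ℝ × ℝ :=
  (p.1 * ((1 - p.2.1)/2) * ((1 - p.2.2)/2), p.2.1 * ((1 - p.2.2)/2), p.2.2)

def cubeT : Set (ℝ × ℝ × ℝ) := Set.Ioo (-1) 1 ×ˢ (Set.Ioo (-1) 1 ×ˢ Set.Ioo (-1) 1)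

noncomputable def triL (a b c d e : ℝ) : ℝ × ℝ × ℝ →L[ℝ] ℝ × ℝ × ℝ :=
  (a • ContinuousLinearMap.fst ℝ ℝ (ℝ × ℝ) +
    b • (ContinuousLinearMap.fst ℝ ℝ ℝ).comp (ContinuousLinearMap.snd ℝ ℝ (ℝ × ℝ)) +
    c • (ContinuousLinearMap.snd ℝ ℝ ℝ).comp (ContinuousLinearMap.snd ℝ ℝ (ℝ × ℝ))).prod
  ((d • (ContinuousLinearMap.fst ℝ ℝ ℝ).comp (ContinuousLinearMap.snd ℝ ℝ (ℝ × ℝ)) +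
    e • (ContinuousLinearMap.snd ℝ ℝ ℝ).comp (ContinuousLinearMap.snd ℝ ℝ (ℝ × ℝ))).prod
   ((ContinuousLinearMap.snd ℝ ℝ ℝ).comp (ContinuousLinearMap.snd ℝ ℝ (ℝ × ℝ))))

def e3 : (ℝ × ℝ × ℝ) ≃ₗ[ℝ] (Fin 3 → ℝ) where
  toFun p := ![p.1, p.2.1, p.2.2]
  invFun v := (v 0, v 1, v 2)
  map_add' p q := by ext i; fin_cases i <;> simp
  map_smul' c p := by ext i; fin_cases i <;> simp
  left_inv p := by simp
  right_inv v := by ext i; fin_cases i <;> simp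

lemma triL_det (a b c d e : ℝ) : (triL a b c d e).det = a * d := by
  have h : (e3 : (ℝ × ℝ × ℝ) →ₗ[ℝ] (Fin 3 → ℝ)) ∘ₗ (triL a b c d e : (ℝ × ℝ × ℝ) →ₗ[ℝ] ℝ × ℝ × ℝ) ∘ₗ
      (e3.symm : (Fin 3 → ℝ) →ₗ[ℝ] (ℝ × ℝ × ℝ)) = Matrix.toLin' !![a, b, c; 0, d, e; 0, 0, 1] := by
    apply LinearMap.ext
    intro v
    ext i
    fin_cases i <;> simp [e3, triL, Matrix.mulVec, dotProduct, Fin.sum_univ_three]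
  rw [ContinuousLinearMap.det, ← LinearMap.det_conj _ e3, h, LinearMap.det_toLin', Matrix.det_fin_three]
  simp

lemma phiT_deriv (p : ℝ × ℝ × ℝ) : HasFDerivAt phiT
    (triL (((1 - p.2.1)/2) * ((1 - p.2.2)/2)) (-p.1/2 * ((1 - p.2.2)/2)) (-p.1 * ((1 - p.2.1)/2)/2)
      ((1 - p.2.2)/2) (-p.2.1/2)) p := by
  have h1 : HasFDerivAt (fun p : ℝ × ℝ × ℝ => p.1) (ContinuousLinearMap.fst ℝ ℝ (ℝ × ℝ)) p := hasFDerivAt_fst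
  have h2 : HasFDerivAt (fun p : ℝ × ℝ × ℝ => p.2.1)
     ((ContinuousLinearMap.fst ℝ ℝ ℝ).comp (ContinuousLinearMap.snd ℝ ℝ (ℝ × ℝ))) p :=
     hasFDerivAt_fst.comp p hasFDerivAt_snd
  have h3 : HasFDerivAt (fun p : ℝ × ℝ × ℝ => p.2.2)
     ((ContinuousLinearMap.snd ℝ ℝ ℝ).comp (ContinuousLinearMap.snd ℝ ℝ (ℝ × ℝ))) p :=
     hasFDerivAt_snd.comp p hasFDerivAt_snd
  have h2' := (h2.const_sub 1).mul_const (2⁻¹:ℝ)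
  have h3' := (h3.const_sub 1).mul_const (2⁻¹:ℝ)
  have := ((h1.mul h2').mul h3').prodMk ((h2.mul h3').prodMk h3)
  simp only [← div_eq_mul_inv] at this
  refine HasFDerivAt.congr_fderiv (f := phiT) this ?_
  apply ContinuousLinearMap.ext
  rintro ⟨x, y, z⟩
  simp [triL]
  constructor <;> ring

lemma phiT_inj : Set.InjOn phiT cubeT := by
  rintro ⟨x, y, z⟩ ⟨⟨hx1, hx2⟩, ⟨hy1, hy2⟩, ⟨hz1, hz2⟩⟩ ⟨x', y', z'⟩ _ h
  simp only [phiT, Prod.mk.injEq] at h hx1 hx2 hy1 hy2 hz1 hz2 ⊢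
  obtain ⟨h1, h2, rfl⟩ := h
  have hz : (1 - z)/2 ≠ 0 := by linarith
  have := mul_right_cancel₀ hz h2
  subst this
  have hy : (1 - y)/2 ≠ 0 := by linarith
  exact ⟨mul_right_cancel₀ hy (mul_right_cancel₀ hz h1), rfl, rfl⟩

lemma phiT_image : phiT '' cubeT = Tet := by
  ext ⟨x, y, z⟩
  constructor
  · rintro ⟨⟨a, b, c⟩, ⟨⟨hx1, hx2⟩, ⟨hy1, hy2⟩, ⟨hz1, hz2⟩⟩, h⟩
    simp only [phiT, Prod.mk.injEq] at h hx1 hx2 hy1 hy2 hz1 hz2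
    obtain ⟨rfl, rfl, rfl⟩ := h
    have hw : 0 < (1 - c)/2 := by linarith
    have hu : 0 < (1 - b)/2 := by linarith
    refine ⟨hz1, hz2, ?_, ?_⟩
    · simp only [abs_mul, abs_of_pos hw]
      have := abs_lt.2 ⟨hy1, hy2⟩
      nlinarith
    · simp only [abs_mul, abs_of_pos hw, abs_of_pos hu]
      have := abs_lt.2 ⟨hx1, hx2⟩
      have := mul_lt_mul_of_pos_right this (mul_pos hu hw)
      linarith
  · rintro ⟨hz1, hz2, hy, hx⟩
    simp only at hz1 hz2 hx hy
    have hw : 0 < 1 - z := by linarith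
    rw [abs_lt] at hx hy
    have hu : 0 < 1 - 2*y - z := by linarith
    refine ⟨(4*x/(1-2*y-z), 2*y/(1-z), z), ⟨⟨?_, ?_⟩, ⟨?_, ?_⟩, ⟨hz1, hz2⟩⟩, ?_⟩
    · simp only; rw [lt_div_iff₀ hu]; linarith
    · simp only; rw [div_lt_iff₀ hu]; linarith
    · simp only; rw [lt_div_iff₀ hw]; linarith
    · simp only; rw [div_lt_iff₀ hw]; linarith
    · simp only [phiT, Prod.mk.injEq, and_true]
      have : 1 - z - 2*y ≠ 0 := by linarith
      have : 1 - 2*y - z ≠ 0 := by linarith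
      have : 1 - z ≠ 0 := by linarith
      constructor
      · field_simp; ring_nf
      · field_simp

lemma cov (g : ℝ × ℝ × ℝ → ℝ) : ∫ p in Tet, g p =
    ∫ p in cubeT, (((1 - p.2.1)/2) * ((1 - p.2.2)/2)^2) * g (phiT p) := by
  have hm : MeasurableSet cubeT := measurableSet_Ioo.prod (measurableSet_Ioo.prod measurableSet_Ioo)
  have : (volume : Measure (ℝ × ℝ × ℝ)).IsAddHaarMeasure := by
    have h2 : (volume : Measure (ℝ × ℝ)).IsAddHaarMeasure :=
      Measure.prod.instIsAddHaarMeasure (volume : Measure ℝ) (volume : Measure ℝ)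
    exact Measure.prod.instIsAddHaarMeasure (volume : Measure ℝ) (volume : Measure (ℝ × ℝ))
  rw [← phiT_image, integral_image_eq_integral_abs_det_fderiv_smul volume hm
    (fun p _ => (phiT_deriv p).hasFDerivWithinAt) phiT_inj]
  refine setIntegral_congr_fun hm ?_
  rintro ⟨x, y, z⟩ ⟨⟨hx1, hx2⟩, ⟨hy1, hy2⟩, ⟨hz1, hz2⟩⟩
  simp only at hx1 hx2 hy1 hy2 hz1 hz2
  have hw : 0 < (1 - z)/2 := by linarith
  have hu : 0 < (1 - y)/2 := by linarith
  simp only [triL_det, smul_eq_mul]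
  rw [abs_of_pos (by positivity)]
  ring

end aux

/-- The diagonal value `∫_▲ ṽ^II_{ijk} · b̃^II_{ijk}`. -/
theorem tetrahedron_Hcurl_diagonal_II (i j k : ℕ) (hi : 2 ≤ i) (hj : 1 ≤ j)
    (hk : 1 ≤ k) :
    ∫ p in Tet, dot3 (vtTetII i j k p) (btTetII i j k p) =
      64 / ((2*(i:ℝ) - 1) * (2*(j:ℝ) + 2*(i:ℝ) - 1) *
        (2*(k:ℝ) + 2*(i:ℝ) + 2*(j:ℝ) - 1) * ((k:ℝ) + 2*(i:ℝ) + 2*(j:ℝ) - 1)) := by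
  obtain ⟨i, rfl⟩ := Nat.exists_eq_add_of_le' hi
  obtain ⟨j, rfl⟩ := Nat.exists_eq_add_of_le' hj
  obtain ⟨k, rfl⟩ := Nat.exists_eq_add_of_le' hk
  rw [cov]
  have hm : MeasurableSet cubeT := measurableSet_Ioo.prod (measurableSet_Ioo.prod measurableSet_Ioo)
  have key : ∀ p ∈ cubeT, (((1 - p.2.1)/2) * ((1 - p.2.2)/2)^2) *
      dot3 (vtTetII (i+2) (j+1) (k+1) (phiT p)) (btTetII (i+2) (j+1) (k+1) (phiT p)) =
      (fun x => (-2*((i:ℝ)+2)) * (intLegendreP (i+2) x * jacobiP i 1 1 x)) p.1 *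
      (fun q : ℝ × ℝ => (fun y => ((1-y)/2)^(2*(i+2)) * (jacobiP j (2*(i+2)) 0 y)^2) q.1 *
       (fun z => ((1-z)/2)^(2*i+2*j+5) * (intJacobiP (k+1) (2*i+2*j+5+1) z * jacobiP k (2*i+2*j+5) 1 z)) q.2) p.2 := by
    rintro ⟨x, y, z⟩ ⟨⟨hx1, hx2⟩, ⟨hy1, hy2⟩, ⟨hz1, hz2⟩⟩
    simp only at hx1 hx2 hy1 hy2 hz1 hz2
    have hw : 1 - z ≠ 0 := by linarith
    have hu : 1 - y ≠ 0 := by linarith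
    have hc : chiT (phiT (x, y, z)) = y := by simp only [chiT, phiT]; field_simp
    have he : etaT (phiT (x, y, z)) = x := by
      simp only [etaT, phiT]
      rw [show 1 - 2*(y*((1-z)/2)) - z = (1-y)*(1-z) by ring]; field_simp; ring_nf
    have hz : (phiT (x, y, z)).2.2 = z := rfl
    simp only [dot3, vtTetII, btTetII, hc, he, hz, Nat.add_sub_cancel,
      show i+2-1 = i+1 by omega, show i+2+(j+1)-2 = i+j+1 by omega,
      show 2*(i+2)+2*(j+1)-1 = 2*i+2*j+5 by omega, show 2*(i+2)+2*(j+1) = 2*i+2*j+5+1 by ring]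
    push_cast
    ring
  rw [setIntegral_congr_fun hm key]
  refine (setIntegral_prod_mul (μ := (volume : Measure ℝ)) (ν := (volume : Measure (ℝ × ℝ)))
    (fun x => (-2*((i:ℝ)+2)) * (intLegendreP (i+2) x * jacobiP i 1 1 x))
    (fun q : ℝ × ℝ => (((1-q.1)/2)^(2*(i+2)) * (jacobiP j (2*(i+2)) 0 q.1)^2) *
      (((1-q.2)/2)^(2*i+2*j+5) * (intJacobiP (k+1) (2*i+2*j+5+1) q.2 *
        jacobiP k (2*i+2*j+5) 1 q.2)))
    (Set.Ioo (-1) 1) (Set.Ioo (-1) 1 ×ˢ Set.Ioo (-1) 1)).trans ?_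
  have P := setIntegral_prod_mul (μ := (volume : Measure ℝ)) (ν := (volume : Measure ℝ))
    (fun y => ((1-y)/2)^(2*(i+2)) * (jacobiP j (2*(i+2)) 0 y)^2)
    (fun z => ((1-z)/2)^(2*i+2*j+5) * (intJacobiP (k+1) (2*i+2*j+5+1) z *
      jacobiP k (2*i+2*j+5) 1 z)) (Set.Ioo (-1) 1) (Set.Ioo (-1) 1)
  refine (congrArg₂ (· * ·) (eta_int i) (P.trans (congrArg₂ (· * ·) (chi_int j _) (z_int k _)))).trans ?_
  push_cast
  rw [div_mul_div_comm, div_mul_div_comm]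
  congr 1
  · norm_num
  · ring
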